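/- Decomposition of a simply generated Łukasiewicz bridge into a nondecreasing bridge and the positions of its negative steps (Lemma 4.2). Given a weight sequence θ, define p(k) = θ(k+1) for every k ≥ 0, and define q by q(0) = q(1) = 1 and q(k) = 0 for k ≥ 2. Fix 1 ≤ K_n ≤ n. Independently, sample (S^{n−K_n}_k)_{0≤k≤n−K_n} with distribution P^{p, n−K_n}_{K_n−1} and (L^n_k)_{0≤k≤n} with distribution P^{q,n}_{K_n}. For every 0 ≤ k ≤ n, set W^n_k = S^{n−K_n}_{k − L^n_k} − L^n_k. Then the path (W^n_k)_{0≤k≤n} has law P^θ_{n,K_n}. -/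

import Mathlib

open Filter Topology
open scoped Classical

set_option autoImplicit false

/-- Extension of a finite tuple by `0`. -/
def fext {M : Type*} [Zero M] {n : ℕ} (d : Fin n → M) (i : ℕ) : M :=
  if h : i < n then d ⟨i, h⟩ else 0

/-- The weight, under the weight sequence `θ`, of the Łukasiewicz bridge with increment
sequence `d`: it is `∏_k θ(d_k + 1)` if `d` has all increments `≥ -1`, total sum `-1` and
exactly `K` increments equal to `-1` (i.e. the path lies in `B_{n,K}`), and `0` otherwise. -/
noncomputable def wB (θ : ℕ → ℝ) (n K : ℕ) (d : Fin n → ℤ) : ℝ :=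
  if (∀ i, -1 ≤ d i) ∧ (∑ i, d i = -1) ∧
      (Finset.univ.filter (fun i => d i = -1)).card = K
  then ∏ i, θ (d i + 1).toNat else 0

/-- The weight of the increment sequence `d` as an excursion-type path in `W_{n,K}`:
as `wB`, but additionally all partial sums up to time `n-1` must be nonnegative. -/
noncomputable def wW (θ : ℕ → ℝ) (n K : ℕ) (d : Fin n → ℤ) : ℝ :=
  if ∀ k, 1 ≤ k → k ≤ n - 1 → 0 ≤ ∑ i ∈ Finset.range k, fext d i
  then wB θ n K d else 0

/-- Total weight `Z = ∑_{paths 0 → x in n nondecreasing steps} ∏ r(increments)`; paths are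
encoded by their increment tuples, i.e. tuples `f : Fin n → ℕ` with `∑ f i = x`. -/
noncomputable def Zweight (r : ℕ → ℝ) (n x : ℕ) : ℝ :=
  ∑ f ∈ Finset.Nat.antidiagonalTuple n x, ∏ i, r (f i)


/-- Increments of the composed path. -/
noncomputable def DD {m n : ℕ} (f : Fin m → ℕ) (g : Fin n → ℕ) (i : Fin n) : ℤ :=
  if g i = 0 then ((fext f (Nat.count (fun j => fext g j = 0) i) : ℕ) : ℤ) else -1

lemma fext_fin {M : Type*} [Zero M] {n : ℕ} (d : Fin n → M) (i : Fin n) : fext d i = d i := by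
  simp [fext]

lemma fext_lt {M : Type*} [Zero M] {n : ℕ} (d : Fin n → M) (i : ℕ) (h : i < n) :
    fext d i = d ⟨i, h⟩ := by
  simp [fext, h]

lemma sum_fext {M : Type*} [AddCommMonoid M] {n : ℕ} (d : Fin n → M) :
    ∑ i ∈ Finset.range n, fext d i = ∑ i, d i := by
  rw [Finset.sum_range]; simp [fext_fin]

lemma fext_le_one {n : ℕ} (g : Fin n → ℕ) (hg : ∀ i, g i ≤ 1) (i : ℕ) : fext g i ≤ 1 := by
  unfold fext; split_ifs with h
  · exact hg _
  · simp

lemma count_add {n : ℕ} (g : Fin n → ℕ) (hg : ∀ i, g i ≤ 1) (k : ℕ) :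
    Nat.count (fun j => fext g j = 0) k + ∑ i ∈ Finset.range k, fext g i = k := by
  induction k with
  | zero => simp
  | succ k ih =>
    rw [Nat.count_succ, Finset.sum_range_succ]
    have := fext_le_one g hg k
    split_ifs <;> omega

lemma fext_DD {m n : ℕ} (f : Fin m → ℕ) (g : Fin n → ℕ) (k : ℕ) (hk : k < n) :
    fext (DD f g) k =
      if fext g k = 0 then ((fext f (Nat.count (fun j => fext g j = 0) k) : ℕ) : ℤ) else -1 := by
  rw [fext_lt _ _ hk, DD, fext_lt g _ hk]

lemma sum_DD {m n : ℕ} (f : Fin m → ℕ) (g : Fin n → ℕ) (hg : ∀ i, g i ≤ 1) (k : ℕ)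
    (hk : k ≤ n) :
    ∑ i ∈ Finset.range k, fext (DD f g) i =
      ((∑ i ∈ Finset.range (Nat.count (fun j => fext g j = 0) k), fext f i : ℕ) : ℤ)
        - ((∑ i ∈ Finset.range k, fext g i : ℕ) : ℤ) := by
  induction k with
  | zero => simp
  | succ k ih =>
    rw [Nat.count_succ, Finset.sum_range_succ, Finset.sum_range_succ, ih (by omega),
      fext_DD f g k (by omega)]
    have := fext_le_one g hg k
    split_ifs with h
    · rw [Finset.sum_range_succ, h]; push_cast; ring
    · have : fext g k = 1 := by omega
      rw [this]; push_cast; ring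

lemma prod_DD (θ : ℕ → ℝ) {m n : ℕ} (f : Fin m → ℕ) (g : Fin n → ℕ) (hg : ∀ i, g i ≤ 1) (k : ℕ)
    (hk : k ≤ n) :
    ∏ i ∈ Finset.range k, θ (fext (DD f g) i + 1).toNat =
      θ 0 ^ (∑ i ∈ Finset.range k, fext g i) *
      ∏ i ∈ Finset.range (Nat.count (fun j => fext g j = 0) k), θ (fext f i + 1) := by
  induction k with
  | zero => simp
  | succ k ih =>
    rw [Nat.count_succ, Finset.prod_range_succ, Finset.sum_range_succ, ih (by omega),
      fext_DD f g k (by omega)]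
    have := fext_le_one g hg k
    split_ifs with h
    · rw [Finset.prod_range_succ, h]
      have : (((fext f (Nat.count (fun j => fext g j = 0) k) : ℕ) : ℤ) + 1).toNat
        = fext f (Nat.count (fun j => fext g j = 0) k) + 1 := by omega
      rw [this]; simp only [add_zero]; ring
    · have : fext g k = 1 := by omega
      rw [this]; simp [pow_succ]; ring_nf

lemma DD_eq_neg {m n : ℕ} (f : Fin m → ℕ) (g : Fin n → ℕ) (hg : ∀ i, g i ≤ 1) (i : Fin n) :
    DD f g i = -1 ↔ g i = 1 := by
  have := hg i
  unfold DD
  split_ifs with h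
  · simp [h]
  · exact ⟨fun _ => by omega, fun _ => rfl⟩

lemma count_n {n K : ℕ} (g : Fin n → ℕ) (hg : ∀ i, g i ≤ 1) (hs : ∑ i, g i = K) :
    Nat.count (fun j => fext g j = 0) n = n - K := by
  have := count_add g hg n
  rw [sum_fext, hs] at this
  omega

lemma wB_DD (θ : ℕ → ℝ) {n K : ℕ} (hK : 1 ≤ K) (f : Fin (n - K) → ℕ) (g : Fin n → ℕ)
    (hg : ∀ i, g i ≤ 1) (hf : ∑ i, f i = K - 1) (hs : ∑ i, g i = K) :
    wB θ n K (DD f g) = θ 0 ^ K * ∏ i, θ (f i + 1) := by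
  have h1 : ∀ i, -1 ≤ DD f g i := by
    intro i; unfold DD; split_ifs <;> omega
  have h2 : ∑ i, DD f g i = -1 := by
    rw [← sum_fext, sum_DD f g hg n le_rfl, count_n g hg hs, sum_fext, sum_fext, hf, hs]; omega
  have h3 : (Finset.univ.filter (fun i => DD f g i = -1)).card = K := by
    refine Eq.trans ?_ hs
    rw [Finset.card_filter]
    refine Finset.sum_congr rfl fun i _ => ?_
    have hi := DD_eq_neg f g hg i
    have := hg i
    split_ifs <;> omega
  unfold wB
  rw [if_pos ⟨h1, h2, h3⟩]
  have := prod_DD θ f g hg n le_rfl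
  rw [count_n g hg hs, sum_fext, hs, Finset.prod_range, Finset.prod_range] at this
  simpa [fext_fin] using this

lemma infP {n : ℕ} (g : Fin n → ℕ) : {j | fext g j = 0}.Infinite := by
  refine (Set.Ici_infinite n).mono ?_
  intro j hj
  simp only [Set.mem_Ici] at hj
  simp [fext, hj]

lemma DD_inj {n K : ℕ} (f f' : Fin (n - K) → ℕ) (g g' : Fin n → ℕ)
    (hg : ∀ i, g i ≤ 1) (hg' : ∀ i, g' i ≤ 1) (hs : ∑ i, g i = K)
    (h : DD f g = DD f' g') : f = f' ∧ g = g' := by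
  have e : g = g' := by
    funext i
    have a := DD_eq_neg f g hg i
    have b := DD_eq_neg f' g' hg' i
    rw [h] at a
    have := hg i
    have := hg' i
    have := a.symm.trans b
    omega
  subst e
  refine ⟨?_, rfl⟩
  funext j
  have hj : Nat.nth (fun j => fext g j = 0) j < n :=
    Nat.nth_lt_of_lt_count (by rw [count_n g hg hs]; exact j.2)
  have hP : fext g (Nat.nth (fun j => fext g j = 0) j) = 0 :=
    Nat.nth_mem_of_infinite (infP g) j
  have := congrArg (fun d => fext d (Nat.nth (fun j => fext g j = 0) j)) h
  simp only [fext_DD _ _ _ hj, if_pos hP, Nat.count_nth_of_infinite (infP g), fext_fin] at this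
  exact_mod_cast this

lemma DD_surj {n K : ℕ} (hK : 1 ≤ K) (d : Fin n → ℤ) (h1 : ∀ i, -1 ≤ d i)
    (h2 : ∑ i, d i = -1)
    (h3 : (Finset.univ.filter (fun i => d i = -1)).card = K) :
    ∃ (f : Fin (n - K) → ℕ) (g : Fin n → ℕ), (∀ i, g i ≤ 1) ∧ ∑ i, f i = K - 1 ∧
      ∑ i, g i = K ∧ DD f g = d := by
  let g : Fin n → ℕ := fun i => if d i = -1 then 1 else 0
  let f : Fin (n - K) → ℕ := fun j => (fext d (Nat.nth (fun j => fext g j = 0) j)).toNat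
  have hg : ∀ i, g i ≤ 1 := by intro i; simp only [g]; split_ifs <;> simp
  have hs : ∑ i, g i = K := by rw [← h3, Finset.card_filter]
  have hD : DD f g = d := by
    funext i
    unfold DD
    split_ifs with h
    · have hP : fext g i = 0 := by rw [fext_fin, h]
      have hc : Nat.count (fun j => fext g j = 0) i < n - K := by
        rw [← count_n g hg hs]
        exact Nat.count_strict_mono (p := fun j => fext g j = 0) hP i.2
      rw [fext_lt _ _ hc]
      simp only [f]
      rw [Nat.nth_count (p := fun j => fext g j = 0) hP, fext_fin]
      have : d i ≠ -1 := by
        intro h'; simp [g, h'] at h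
      have := h1 i
      omega
    · by_contra h'
      exact h (by simp only [g]; rw [if_neg (fun h'' => h' h''.symm)])
  refine ⟨f, g, hg, ?_, hs, hD⟩
  have := sum_DD f g hg n le_rfl
  rw [hD, count_n g hg hs, sum_fext, sum_fext, sum_fext, h2, hs] at this
  omega

lemma master (θ p q : ℕ → ℝ) (hp : ∀ k, p k = θ (k + 1))
    (hq0 : q 0 = 1) (hq1 : q 1 = 1) (hq2 : ∀ k, 2 ≤ k → q k = 0)
    (n K : ℕ) (hK : 1 ≤ K) (F : (Fin n → ℤ) → ℝ) :
    ∑' d : Fin n → ℤ, F d * wB θ n K d =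
      θ 0 ^ K * ∑ f ∈ Finset.Nat.antidiagonalTuple (n - K) (K - 1),
        ∑ g ∈ Finset.Nat.antidiagonalTuple n K,
          F (DD f g) * ((∏ i, p (f i)) * ∏ i, q (g i)) := by
  let T := (Finset.Nat.antidiagonalTuple (n - K) (K - 1)) ×ˢ
    ((Finset.Nat.antidiagonalTuple n K).filter (fun g => ∀ i, g i ≤ 1))
  have hT : ∀ x ∈ T, (∑ i, x.1 i = K - 1) ∧ (∑ i, x.2 i = K) ∧ ∀ i, x.2 i ≤ 1 := by
    intro x hx
    simpa [T, Finset.Nat.mem_antidiagonalTuple] using hx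
  rw [tsum_eq_sum (s := T.image (fun x => DD x.1 x.2)), Finset.sum_image]
  · rw [Finset.sum_product, Finset.mul_sum]
    refine Finset.sum_congr rfl fun f hf => ?_
    rw [Finset.mul_sum, Finset.sum_filter]
    refine Finset.sum_congr rfl fun g hg => ?_
    rw [Finset.Nat.mem_antidiagonalTuple] at hf hg
    split_ifs with h
    · rw [wB_DD θ hK f g h hf hg]
      have : ∏ i, q (g i) = 1 := by
        refine Finset.prod_eq_one fun i _ => ?_
        have := h i
        interval_cases g i <;> assumption
      rw [this]
      simp only [hp]
      ring
    · push Not at h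
      obtain ⟨i, hi⟩ := h
      rw [Finset.prod_eq_zero (Finset.mem_univ i) (hq2 (g i) (by omega))]
      ring
  · intro x hx y hy hxy
    obtain ⟨a1, a2, a3⟩ := hT x hx
    obtain ⟨b1, b2, b3⟩ := hT y hy
    obtain ⟨c1, c2⟩ := DD_inj x.1 y.1 x.2 y.2 a3 b3 a2 hxy
    exact Prod.ext c1 c2
  · intro d hd
    unfold wB
    split_ifs with h
    · exfalso
      apply hd
      obtain ⟨f, g, hg, hf, hs, hD⟩ := DD_surj hK d h.1 h.2.1 h.2.2
      refine Finset.mem_image.2 ⟨(f, g), ?_, hD⟩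
      simp [T, Finset.Nat.mem_antidiagonalTuple, hf, hs, hg]
    · simp

/-- **Decomposition of a simply generated Łukasiewicz bridge into a nondecreasing bridge
and the positions of its negative steps** (Lemma 4.2): if, independently,
`S ∼ P^{p, n−K}_{K−1}` (with `p(k) = θ(k+1)`) and `L ∼ P^{q,n}_K` (with
`q(0) = q(1) = 1`, `q(k) = 0` for `k ≥ 2`), then the path `W_k = S_{k−L_k} − L_k` has law
`P^θ_{n,K}`. Distributional equality is expressed by equality of the probabilities of
every path `w`; paths are encoded by increment tuples. -/
theorem lukasiewicz_bridge_decomposition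
    (θ : ℕ → ℝ) (hθ_nonneg : ∀ i, 0 ≤ θ i) (hθ0 : 0 < θ 0)
    (hθ2 : ∃ i, 2 ≤ i ∧ 0 < θ i)
    (p q : ℕ → ℝ)
    (hp : ∀ k, p k = θ (k + 1))
    (hq0 : q 0 = 1) (hq1 : q 1 = 1) (hq2 : ∀ k, 2 ≤ k → q k = 0)
    (n K : ℕ) (hK : 1 ≤ K) (hKn : K ≤ n)
    (hZp : 0 < Zweight p (n - K) (K - 1))
    (hZq : 0 < Zweight q n K)
    (hZB : 0 < ∑' d : Fin n → ℤ, wB θ n K d) :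
    ∀ w : ℕ → ℤ,
      (∑ f ∈ Finset.Nat.antidiagonalTuple (n - K) (K - 1),
        ∑ g ∈ Finset.Nat.antidiagonalTuple n K,
          if ∀ k ≤ n,
              ((∑ i ∈ Finset.range (k - ∑ i ∈ Finset.range k, fext g i), fext f i : ℕ) : ℤ)
                - ((∑ i ∈ Finset.range k, fext g i : ℕ) : ℤ) = w k
          then (∏ i, p (f i)) * ∏ i, q (g i) else 0)
        / (Zweight p (n - K) (K - 1) * Zweight q n K)
      = (∑' d : Fin n → ℤ,
          if ∀ k ≤ n, (∑ i ∈ Finset.range k, fext d i) = w k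
          then wB θ n K d else 0) / (∑' d : Fin n → ℤ, wB θ n K d) := by
  intro w
  have hZ := master θ p q hp hq0 hq1 hq2 n K hK (fun _ => 1)
  have hN := master θ p q hp hq0 hq1 hq2 n K hK
    (fun d => if ∀ k ≤ n, (∑ i ∈ Finset.range k, fext d i) = w k then 1 else 0)
  simp only [one_mul, ite_mul, zero_mul] at hZ hN
  have hZ' : ∑' d : Fin n → ℤ, wB θ n K d
      = θ 0 ^ K * (Zweight p (n - K) (K - 1) * Zweight q n K) := by
    rw [hZ, Zweight, Zweight, Finset.sum_mul_sum]
  rw [hN, hZ', mul_div_mul_left _ _ (pow_pos hθ0 K).ne']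
  congr 1
  refine Finset.sum_congr rfl fun f hf => Finset.sum_congr rfl fun g hg => ?_
  by_cases h : ∀ i, g i ≤ 1
  · have e : (∀ k ≤ n,
              ((∑ i ∈ Finset.range (k - ∑ i ∈ Finset.range k, fext g i), fext f i : ℕ) : ℤ)
                - ((∑ i ∈ Finset.range k, fext g i : ℕ) : ℤ) = w k) ↔
        ∀ k ≤ n, (∑ i ∈ Finset.range k, fext (DD f g) i) = w k := by
      refine forall_congr' fun k => forall_congr' fun hk => ?_
      rw [sum_DD f g h k hk]
      have : k - ∑ i ∈ Finset.range k, fext g i = Nat.count (fun j => fext g j = 0) k := by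
        have := count_add g h k
        omega
      rw [this]
    simp only [e]
  · push Not at h
    obtain ⟨i, hi⟩ := h
    rw [Finset.prod_eq_zero (Finset.mem_univ i) (hq2 (g i) (by omega))]
    simp
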